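/- In dimension one, there exist constants c₄, δ₄ > 0 such that for all δ ≤ δ₄ and every u : ℝ → ℝ with u(±∞) = ±1 and dist_{H¹(ℝ)}(u, M₀) > δ, one has 𝓕₀(u) > c₄ δ², where 𝓕₀(u) = ∫_ℝ [½|u′|² + F(u)] dx − C* and M₀ = { x ↦ m(x−ξ) : ξ ∈ ℝ }. -/

import Mathlib

open MeasureTheory Real Filter Topology
open scoped ENNReal RealInnerProductSpace

noncomputable section

/-- `Eucl d` is the Euclidean space `ℝ^(d+1)`. -/
abbrev Eucl (d : ℕ) : Type := EuclideanSpace ℝ (Fin (d + 1))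

/-- The unbounded domain `D = ℝ × (0,1)^d`, as a subset of `ℝ^(d+1)`. -/
def domD (d : ℕ) : Set (Eucl d) := {z | ∀ i : Fin d, z i.succ ∈ Set.Ioo (0 : ℝ) 1}

/-- The bounded domain `D_L = (-L,L) × (0,1)^d`. -/
def domDL (d : ℕ) (L : ℝ) : Set (Eucl d) :=
  {z | |z 0| < L ∧ ∀ i : Fin d, z i.succ ∈ Set.Ioo (0 : ℝ) 1}

/-- The standing assumptions on the symmetric double well potential `F`. -/
structure IsStdPotential (F : ℝ → ℝ) : Prop where
  smooth : ContDiff ℝ 3 F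
  symm : ∀ u, F (-u) = F u
  nonneg : ∀ u, 0 ≤ F u
  zero_iff : ∀ u, F u = 0 ↔ u = 1 ∨ u = -1
  deriv_zero_iff : ∀ u, deriv F u = 0 ↔ u = 0 ∨ u = 1 ∨ u = -1
  dd_zero_neg : deriv (deriv F) 0 < 0
  dd_one_pos : 0 < deriv (deriv F) 1
  dd_neg_one_pos : 0 < deriv (deriv F) (-1)

/-- The surface tension `C* = ∫_{-1}^1 √(2 F(u)) du`. -/
def Cstar (F : ℝ → ℝ) : ℝ := ∫ u in (-1 : ℝ)..1, Real.sqrt (2 * F u)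

/-- `m` is the optimal transition profile for the potential `F`: a solution of
`m' = √(2F(m))`, `m(±∞) = ±1`, `m(0) = 0`, with values in `[-1,1]`. -/
structure IsProfile (F m : ℝ → ℝ) : Prop where
  mem_Icc : ∀ x, m x ∈ Set.Icc (-1 : ℝ) 1
  ode : ∀ x, HasDerivAt m (Real.sqrt (2 * F (m x))) x
  limit_top : Tendsto m atTop (nhds 1)
  limit_bot : Tendsto m atBot (nhds (-1))
  zero : m 0 = 0

/-- A nonnegative `C²` function controls the square of its derivative on bounded sets. -/
lemma exists_sq_deriv_le {F : ℝ → ℝ} (hF : ContDiff ℝ 2 F) (h0 : ∀ u, 0 ≤ F u) (R : ℝ) :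
    ∃ C > 0, ∀ u ∈ Set.Icc (-R) R, (deriv F u) ^ 2 ≤ C * F u := by
  have hd : ContDiff ℝ 1 (deriv F) := hF.deriv'
  obtain ⟨M₁, hM₁⟩ := (isCompact_Icc (a := -R) (b := R)).exists_bound_of_continuousOn
    hd.continuous.continuousOn
  obtain ⟨M₂, hM₂⟩ := (isCompact_Icc (a := -R - 1) (b := R + 1)).exists_bound_of_continuousOn
    (hd.continuous_deriv le_rfl).continuousOn
  set M := max 1 (max M₁ M₂)
  have hM : 1 ≤ M := le_max_left _ _
  have hM1 : M₁ ≤ M := (le_max_left _ _).trans (le_max_right _ _)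
  have hM2 : M₂ ≤ M := (le_max_right _ _).trans (le_max_right _ _)
  refine ⟨4 * M, by positivity, fun u hu => ?_⟩
  set h := -deriv F u / (2 * M) with hh
  have hb : |deriv F u| ≤ M := (hM₁ u hu).trans hM1
  have hh1 : |h| ≤ 1 := by
    rw [hh, abs_div, abs_neg, abs_of_pos (by positivity : 0 < 2 * M), div_le_one (by positivity)]
    linarith
  have hsub : Set.uIcc u (u + h) ⊆ Set.Icc (-R - 1) (R + 1) := by
    rw [abs_le] at hh1
    apply Set.uIcc_subset_Icc <;> constructor <;> linarith [hu.1, hu.2, hh1.1, hh1.2]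
  have hlip : ∀ x ∈ Set.uIcc u (u + h), ‖deriv F x - deriv F u‖ ≤ M * |h| := by
    intro x hx
    refine ((convex_uIcc u (u + h)).norm_image_sub_le_of_norm_deriv_le
      (fun y _ => hd.differentiable one_ne_zero y)
      (fun y hy => (hM₂ y (hsub hy)).trans hM2) Set.left_mem_uIcc hx).trans ?_
    have := Set.abs_sub_left_of_mem_uIcc hx
    rw [add_sub_cancel_left] at this
    exact mul_le_mul_of_nonneg_left this (by positivity)
  have hmv := (convex_uIcc u (u + h)).norm_image_sub_le_of_norm_hasDerivWithin_le
    (f := fun y => F y - deriv F u * y) (f' := fun y => deriv F y - deriv F u)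
    (fun y _ => (((hF.differentiable two_ne_zero y).hasDerivAt.sub
      (by simpa using (hasDerivAt_id y).const_mul (deriv F u)))).hasDerivWithinAt)
    hlip Set.left_mem_uIcc Set.right_mem_uIcc
  have h1 := (abs_le.1 hmv).2
  have h2 := h0 (u + h)
  have h3 : |u + h - u| = |h| := by simp
  rw [Real.norm_eq_abs, h3, mul_assoc, abs_mul_abs_self] at h1
  have h4 : deriv F u = -2 * M * h := by rw [hh]; field_simp
  rw [h4] at h1 ⊢
  nlinarith

/-- The square root of a nonnegative `C²` function is Lipschitz on bounded sets. -/
lemma exists_lipschitz_sqrt {F : ℝ → ℝ} (hF : ContDiff ℝ 2 F) (h0 : ∀ u, 0 ≤ F u) (R : ℝ) :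
    ∃ L > 0, ∀ a ∈ Set.Icc (-R) R, ∀ b ∈ Set.Icc (-R) R,
      |√(2 * F a) - √(2 * F b)| ≤ L * |a - b| := by
  obtain ⟨C, hC, hCF⟩ := exists_sq_deriv_le hF h0 R
  refine ⟨√C, Real.sqrt_pos.2 hC, fun a ha b hb => ?_⟩
  have key : ∀ ε > 0, |√(2 * F a + ε) - √(2 * F b + ε)| ≤ √C * |a - b| := by
    intro ε hε
    refine (convex_Icc (-R) R).norm_image_sub_le_of_norm_hasDerivWithin_le
      (f := fun y => √(2 * F y + ε))
      (f' := fun y => (2 * deriv F y) / (2 * √(2 * F y + ε))) (fun y _ => ?_) (fun y hy => ?_) hb ha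
    · have := ((hF.differentiable two_ne_zero y).hasDerivAt.const_mul 2).add_const ε
      exact (this.sqrt (by linarith [h0 y])).hasDerivWithinAt
    · have hp : 0 < 2 * F y + ε := by linarith [h0 y]
      rw [mul_div_mul_left _ _ two_ne_zero, norm_div, Real.norm_of_nonneg (Real.sqrt_nonneg _),
        div_le_iff₀ (Real.sqrt_pos.2 hp), ← Real.sqrt_mul hC.le]
      apply Real.abs_le_sqrt
      nlinarith [hCF y hy, h0 y]
  have hlim : Tendsto (fun ε : ℝ => |√(2 * F a + ε) - √(2 * F b + ε)|) (𝓝[>] 0)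
      (𝓝 |√(2 * F a) - √(2 * F b)|) := by
    have : Continuous (fun ε : ℝ => |√(2 * F a + ε) - √(2 * F b + ε)|) := by fun_prop
    simpa using (this.tendsto 0).mono_left nhdsWithin_le_nhds
  exact le_of_tendsto hlim (eventually_mem_nhdsWithin.mono key)

/-- Near a nondegenerate critical point `p` with positive second derivative, the function minus a
small parabola is antitone to the left and monotone to the right of `p`. -/
lemma exists_sub_parabola_monotone {F : ℝ → ℝ} (hF : ContDiff ℝ 2 F) {p : ℝ}
    (hp : deriv F p = 0) (hpp : 0 < deriv (deriv F) p) :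
    ∃ α > 0, ∃ r > 0, AntitoneOn (fun x => F x - α / 2 * (x - p) ^ 2) (Set.Icc (p - r) p) ∧
      MonotoneOn (fun x => F x - α / 2 * (x - p) ^ 2) (Set.Icc p (p + r)) := by
  have hd : ContDiff ℝ 1 (deriv F) := hF.deriv'
  have hdc : Continuous (deriv (deriv F)) := hd.continuous_deriv le_rfl
  set α := deriv (deriv F) p / 2 with hα
  have hα0 : 0 < α := by positivity
  obtain ⟨r, hr, hball⟩ := Metric.nhds_basis_closedBall.eventually_iff.1
    (hdc.continuousAt.eventually_const_lt (show α < deriv (deriv F) p by linarith))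
  have hH : ∀ x, HasDerivAt (fun x => F x - α / 2 * (x - p) ^ 2) (deriv F x - α * (x - p)) x := by
    intro x
    exact ((hF.differentiable two_ne_zero x).hasDerivAt.sub
      ((((hasDerivAt_id x).sub_const p).pow 2).const_mul (α / 2))).congr_deriv (by simp; ring)
  have hH' : ∀ x, HasDerivAt (fun x => deriv F x - α * (x - p)) (deriv (deriv F) x - α) x := by
    intro x
    exact ((hd.differentiable one_ne_zero x).hasDerivAt.sub
      (((hasDerivAt_id x).sub_const p).const_mul α)).congr_deriv (by simp)
  have hmono : MonotoneOn (fun x => deriv F x - α * (x - p)) (Metric.closedBall p r) := by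
    refine monotoneOn_of_deriv_nonneg (convex_closedBall p r)
      (fun x _ => (hH' x).continuousAt.continuousWithinAt)
      (fun x _ => (hH' x).differentiableAt.differentiableWithinAt) fun x hx => ?_
    rw [(hH' x).deriv]
    linarith [hball (interior_subset hx)]
  rw [Real.closedBall_eq_Icc] at hmono
  refine ⟨α, hα0, r, hr, ?_, ?_⟩
  · refine antitoneOn_of_deriv_nonpos (convex_Icc _ _)
      (fun x _ => (hH x).continuousAt.continuousWithinAt)
      (fun x _ => (hH x).differentiableAt.differentiableWithinAt) fun x hx => ?_
    have hx := interior_subset hx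
    have := hmono ⟨hx.1, by linarith [hx.2]⟩ ⟨by linarith, by linarith⟩ hx.2
    rw [(hH x).deriv]
    simpa [hp] using this
  · refine monotoneOn_of_deriv_nonneg (convex_Icc _ _)
      (fun x _ => (hH x).continuousAt.continuousWithinAt)
      (fun x _ => (hH x).differentiableAt.differentiableWithinAt) fun x hx => ?_
    have hx := interior_subset hx
    have := hmono ⟨by linarith, by linarith⟩ ⟨by linarith [hx.1], hx.2⟩ hx.1
    rw [(hH x).deriv]
    simpa [hp] using this

/-- The root `√(2F)`, with its sign flipped outside of `[-1, 1]`, so that the wells of `F` become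
transversal zeros. -/
def signedRoot (F : ℝ → ℝ) (u : ℝ) : ℝ := if |u| ≤ 1 then √(2 * F u) else -√(2 * F u)

lemma signedRoot_of_abs_le {F : ℝ → ℝ} {u : ℝ} (hu : |u| ≤ 1) : signedRoot F u = √(2 * F u) :=
  if_pos hu

lemma signedRoot_of_one_le {F : ℝ → ℝ} (hF : IsStdPotential F) {u : ℝ} (hu : 1 ≤ |u|) :
    signedRoot F u = -√(2 * F u) := by
  rcases hu.eq_or_lt with h | h
  · have h0 : F u = 0 := (hF.zero_iff u).2 ((abs_eq zero_le_one).1 h.symm)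
    simp [signedRoot, h0]
  · exact if_neg (not_le.2 h)

lemma signedRoot_neg {F : ℝ → ℝ} (hF : IsStdPotential F) (u : ℝ) :
    signedRoot F (-u) = signedRoot F u := by
  simp [signedRoot, hF.symm]

lemma signedRoot_sq {F : ℝ → ℝ} (hF : IsStdPotential F) (u : ℝ) :
    signedRoot F u ^ 2 = 2 * F u := by
  have h : 0 ≤ 2 * F u := by linarith [hF.nonneg u]
  unfold signedRoot
  split_ifs
  · exact Real.sq_sqrt h
  · rw [neg_sq, Real.sq_sqrt h]

lemma continuous_signedRoot {F : ℝ → ℝ} (hF : IsStdPotential F) : Continuous (signedRoot F) := by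
  have hc := hF.smooth.continuous
  refine Continuous.if_le (by fun_prop) (by fun_prop) continuous_abs continuous_const fun u hu => ?_
  have h0 : F u = 0 := (hF.zero_iff u).2 ((abs_eq zero_le_one).1 hu)
  simp [h0]

lemma exists_lipschitz_signedRoot {F : ℝ → ℝ} (hF : IsStdPotential F) (R : ℝ) :
    ∃ L > 0, ∀ a ∈ Set.Icc (-R) R, ∀ b ∈ Set.Icc (-R) R,
      |signedRoot F a - signedRoot F b| ≤ L * |a - b| := by
  obtain ⟨L, hL, h⟩ := exists_lipschitz_sqrt (hF.smooth.of_le (by norm_num)) hF.nonneg R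
  have mixed : ∀ a ∈ Set.Icc (-R) R, ∀ b ∈ Set.Icc (-R) R, |a| ≤ 1 → 1 ≤ |b| →
      √(2 * F a) + √(2 * F b) ≤ L * |a - b| := by
    intro a ha b hb ha1 hb1
    obtain ⟨s, hs, hs0, hsR⟩ : ∃ s : ℝ, |a - s| + |s - b| = |a - b| ∧ F s = 0 ∧
        s ∈ Set.Icc (-R) R := by
      rw [abs_le] at ha1
      rcases le_abs.1 hb1 with h | h
      · refine ⟨1, ?_, (hF.zero_iff 1).2 (.inl rfl), by linarith [hb.2], by linarith [hb.2]⟩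
        rw [abs_of_nonpos (by linarith : a - 1 ≤ 0), abs_of_nonpos (by linarith : 1 - b ≤ 0),
          abs_of_nonpos (by linarith : a - b ≤ 0)]
        ring
      · refine ⟨-1, ?_, (hF.zero_iff (-1)).2 (.inr rfl), by linarith [hb.1], by linarith [hb.1]⟩
        rw [abs_of_nonneg (by linarith : 0 ≤ a - -1), abs_of_nonneg (by linarith : 0 ≤ -1 - b),
          abs_of_nonneg (by linarith : 0 ≤ a - b)]
        ring
    have h1 := h a ha s hsR
    have h2 := h s hsR b hb
    simp only [hs0, mul_zero, Real.sqrt_zero, sub_zero, zero_sub, abs_neg,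
      abs_of_nonneg (Real.sqrt_nonneg _)] at h1 h2
    rw [← hs, mul_add]
    exact add_le_add h1 h2
  refine ⟨L, hL, fun a ha b hb => ?_⟩
  rcases le_total |a| 1 with ha1 | ha1 <;> rcases le_total |b| 1 with hb1 | hb1
  · rw [signedRoot_of_abs_le ha1, signedRoot_of_abs_le hb1]
    exact h a ha b hb
  · rw [signedRoot_of_abs_le ha1, signedRoot_of_one_le hF hb1, sub_neg_eq_add,
      abs_of_nonneg (by positivity)]
    exact mixed a ha b hb ha1 hb1
  · rw [signedRoot_of_abs_le hb1, signedRoot_of_one_le hF ha1, abs_sub_comm, sub_neg_eq_add,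
      abs_of_nonneg (by positivity), abs_sub_comm a]
    exact mixed b hb a ha hb1 ha1
  · rw [signedRoot_of_one_le hF ha1, signedRoot_of_one_le hF hb1, neg_sub_neg, abs_sub_comm]
    exact h a ha b hb

/-- Near `1` the signed root decreases at least linearly. -/
lemma exists_signedRoot_decrease {F : ℝ → ℝ} (hF : IsStdPotential F) :
    ∃ κ > 0, ∃ r > 0, ∀ a ∈ Set.Icc (1 - r) (1 + r), ∀ b ∈ Set.Icc (1 - r) (1 + r), a ≤ b →
      signedRoot F b - signedRoot F a ≤ -κ * (b - a) := by
  have hF2 : ContDiff ℝ 2 F := hF.smooth.of_le (by norm_num)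
  obtain ⟨α, hα, r₀, hr₀, hanti, hmono⟩ := exists_sub_parabola_monotone hF2
    ((hF.deriv_zero_iff 1).2 (.inr (.inl rfl))) hF.dd_one_pos
  obtain ⟨L, hL, hlip⟩ := exists_lipschitz_sqrt hF2 hF.nonneg 2
  have hone : F 1 = 0 := (hF.zero_iff 1).2 (.inl rfl)
  set r := min r₀ 1
  have hr0 : r ≤ r₀ := min_le_left _ _
  have hr1 : r ≤ 1 := min_le_right _ _
  have hκ : 0 < α / L := by positivity
  -- both sides of the well are instances of one estimate on square roots
  have root : ∀ a ∈ Set.Icc (-2 : ℝ) 2, ∀ b ∈ Set.Icc (-2 : ℝ) 2, |b - 1| ≤ |a - 1| →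
      F b - α / 2 * (b - 1) ^ 2 ≤ F a - α / 2 * (a - 1) ^ 2 →
      α / L * (|a - 1| - |b - 1|) ≤ √(2 * F a) - √(2 * F b) := by
    intro a ha b hb hab h
    have h1 := hlip a ha 1 (by norm_num)
    have h2 := hlip b hb 1 (by norm_num)
    simp only [hone, mul_zero, Real.sqrt_zero, sub_zero,
      abs_of_nonneg (Real.sqrt_nonneg _)] at h1 h2
    have ea := Real.sq_sqrt (show 0 ≤ 2 * F a by linarith [hF.nonneg a])
    have eb := Real.sq_sqrt (show 0 ≤ 2 * F b by linarith [hF.nonneg b])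
    rw [← sq_abs (b - 1), ← sq_abs (a - 1)] at h
    have pa := Real.sqrt_nonneg (2 * F a)
    have pb := Real.sqrt_nonneg (2 * F b)
    generalize √(2 * F a) = A at *
    generalize √(2 * F b) = B at *
    have qb := abs_nonneg (b - 1)
    generalize |a - 1| = s at *
    generalize |b - 1| = t at *
    have hprod : α * ((s - t) * (s + t)) ≤ (A - B) * (A + B) := by nlinarith
    rw [div_mul_eq_mul_div, div_le_iff₀ hL]
    by_contra! hlt
    have hst : 0 ≤ s - t := by linarith
    rcases (add_nonneg (qb.trans hab) qb).eq_or_lt with h0 | h0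
    · have hs : s = 0 := by linarith
      have ht : t = 0 := by linarith
      subst hs ht
      have hA : A = 0 := by linarith
      have hB : B = 0 := by linarith
      simp [hA, hB] at hlt
    · have hAB : 0 ≤ A - B := by
        by_contra! hneg
        nlinarith [mul_nonneg hα.le (mul_nonneg hst h0.le)]
      nlinarith [mul_le_mul_of_nonneg_left (show A + B ≤ L * (s + t) by linarith) hAB]
  have left : ∀ a ∈ Set.Icc (1 - r) 1, ∀ b ∈ Set.Icc (1 - r) 1, a ≤ b →
      signedRoot F b - signedRoot F a ≤ -(α / L) * (b - a) := by
    intro a ha b hb hab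
    have h := root a ⟨by linarith [ha.1], by linarith [ha.2]⟩ b
      ⟨by linarith [hb.1], by linarith [hb.2]⟩
    rw [abs_of_nonpos (by linarith [ha.2] : a - 1 ≤ 0),
      abs_of_nonpos (by linarith [hb.2] : b - 1 ≤ 0)] at h
    have := h (by linarith) (hanti ⟨by linarith [ha.1], ha.2⟩ ⟨by linarith [hb.1], hb.2⟩ hab)
    rw [signedRoot_of_abs_le (abs_le.2 ⟨by linarith [ha.1], ha.2⟩),
      signedRoot_of_abs_le (abs_le.2 ⟨by linarith [hb.1], hb.2⟩)]
    linarith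
  have right : ∀ a ∈ Set.Icc 1 (1 + r), ∀ b ∈ Set.Icc 1 (1 + r), a ≤ b →
      signedRoot F b - signedRoot F a ≤ -(α / L) * (b - a) := by
    intro a ha b hb hab
    have h := root b ⟨by linarith [hb.1], by linarith [hb.2]⟩ a
      ⟨by linarith [ha.1], by linarith [ha.2]⟩
    rw [abs_of_nonneg (by linarith [ha.1] : 0 ≤ a - 1),
      abs_of_nonneg (by linarith [hb.1] : 0 ≤ b - 1)] at h
    have := h (by linarith) (hmono ⟨ha.1, by linarith [ha.2]⟩ ⟨hb.1, by linarith [hb.2]⟩ hab)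
    rw [signedRoot_of_one_le hF (le_abs.2 (.inl ha.1)),
      signedRoot_of_one_le hF (le_abs.2 (.inl hb.1))]
    linarith
  refine ⟨α / L, hκ, r, by positivity, fun a ha b hb hab => ?_⟩
  have hr : 0 < r := by positivity
  rcases le_total b 1 with h1 | h1
  · exact left a ⟨ha.1, hab.trans h1⟩ b ⟨hb.1, h1⟩ hab
  rcases le_total 1 a with h2 | h2
  · exact right a ⟨h2, ha.2⟩ b ⟨h1, hb.2⟩ hab
  have hl := left a ⟨ha.1, h2⟩ 1 ⟨by linarith, le_rfl⟩ h2
  have hr := right 1 ⟨le_rfl, by linarith⟩ b ⟨h1, hb.2⟩ h1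
  linarith

/-- Linearised stability of the flow of the signed root around the profile on the right half-line:
the possible growth away from the well `1` is controlled by the speed of the profile. -/
lemma exists_signedRoot_stability {F : ℝ → ℝ} (hF : IsStdPotential F) :
    ∃ L > 0, ∃ A > 0, ∃ c > 0, ∃ η > 0, ∀ s ∈ Set.Icc (0 : ℝ) 1, ∀ v, |v| ≤ η →
      |signedRoot F (s + v) - signedRoot F s| ≤ L * |v| ∧
      2 * v * (signedRoot F (s + v) - signedRoot F s) ≤ (A * signedRoot F s - c) * v ^ 2 := by
  obtain ⟨L, hL, hlip⟩ := exists_lipschitz_signedRoot hF 2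
  obtain ⟨κ, hκ, r, hr, hdec⟩ := exists_signedRoot_decrease hF
  set η := min (r / 2) (1 / 2)
  have hη : 0 < η := by positivity
  have hη1 : η ≤ r / 2 := min_le_left _ _
  have hη2 : η ≤ 1 / 2 := min_le_right _ _
  obtain ⟨s₀, hs₀, hmin⟩ := (isCompact_Icc (a := (0 : ℝ)) (b := 1 - η)).exists_isMinOn
    ⟨0, by constructor <;> linarith⟩ (continuous_signedRoot hF).continuousOn
  have hnn : ∀ s ∈ Set.Icc (0 : ℝ) 1, 0 ≤ signedRoot F s := fun s hs => by
    rw [signedRoot_of_abs_le (abs_le.2 ⟨by linarith [hs.1], hs.2⟩)]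
    positivity
  have hw : 0 < signedRoot F s₀ := by
    rw [signedRoot_of_abs_le (abs_le.2 ⟨by linarith [hs₀.1], by linarith [hs₀.2]⟩)]
    refine Real.sqrt_pos.2 (mul_pos two_pos ((hF.nonneg _).lt_of_ne' fun h => ?_))
    rcases (hF.zero_iff _).1 h with h | h <;> linarith [hs₀.1, hs₀.2]
  refine ⟨L, hL, (2 * L + 2 * κ) / signedRoot F s₀, by positivity, 2 * κ, by positivity, η, hη,
    fun s hs v hv => ?_⟩
  have hv' := abs_le.1 hv
  have hl : |signedRoot F (s + v) - signedRoot F s| ≤ L * |v| := by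
    simpa using hlip (s + v) ⟨by linarith [hs.1], by linarith [hs.2]⟩ s
      ⟨by linarith [hs.1], by linarith [hs.2]⟩
  refine ⟨hl, ?_⟩
  rcases le_total (1 - η) s with h | h
  · have hA : 0 ≤ (2 * L + 2 * κ) / signedRoot F s₀ * signedRoot F s * v ^ 2 :=
      mul_nonneg (mul_nonneg (by positivity) (hnn s hs)) (sq_nonneg v)
    have m1 : s + v ∈ Set.Icc (1 - r) (1 + r) := ⟨by linarith, by linarith [hs.2]⟩
    have m2 : s ∈ Set.Icc (1 - r) (1 + r) := ⟨by linarith, by linarith [hs.2]⟩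
    rcases le_total 0 v with h0 | h0
    · have := hdec s m2 (s + v) m1 (by linarith)
      nlinarith
    · have := hdec (s + v) m1 s m2 (by linarith)
      nlinarith
  · have hge : 2 * L + 2 * κ ≤ (2 * L + 2 * κ) / signedRoot F s₀ * signedRoot F s := by
      rw [div_mul_eq_mul_div, le_div_iff₀ hw]
      exact mul_le_mul_of_nonneg_left (hmin ⟨hs.1, h⟩) (by positivity)
    have h1 : v * (signedRoot F (s + v) - signedRoot F s) ≤ L * v ^ 2 := by
      refine (le_abs_self _).trans ?_
      rw [abs_mul, ← sq_abs v]
      nlinarith [mul_le_mul_of_nonneg_left hl (abs_nonneg v)]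
    nlinarith [mul_le_mul_of_nonneg_right hge (sq_nonneg v)]

/-- A continuity argument: a strict bound that propagates from `[0, X)` to `X` holds on `[0, ∞)`. -/
lemma lt_of_forall_Ico_lt {q : ℝ → ℝ} (hq : Continuous q) {b : ℝ}
    (h : ∀ X ≥ 0, (∀ x ∈ Set.Ico 0 X, q x < b) → q X < b) {x : ℝ} (hx : 0 ≤ x) : q x < b := by
  by_contra! hxb
  set S : Set ℝ := Set.Ici 0 ∩ {y | b ≤ q y}
  have hS : IsClosed S := isClosed_Ici.inter (isClosed_le continuous_const hq)
  have hbdd : BddBelow S := ⟨0, fun y hy => hy.1⟩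
  have hmem := hS.csInf_mem ⟨x, hx, hxb⟩ hbdd
  refine (h (sInf S) hmem.1 fun y hy => ?_).not_ge hmem.2
  by_contra! hyb
  exact (csInf_le hbdd ⟨hy.1, hyb⟩).not_gt hy.2

lemma IsProfile.nonneg_of_nonneg {F m : ℝ → ℝ} (hm : IsProfile F m) {x : ℝ} (hx : 0 ≤ x) :
    0 ≤ m x := by
  have : Monotone m := monotone_of_deriv_nonneg (fun x => (hm.ode x).differentiableAt)
    fun x => by rw [(hm.ode x).deriv]; positivity
  simpa [hm.zero] using this hx

lemma IsProfile.hasDerivAt_signedRoot {F m : ℝ → ℝ} (hm : IsProfile F m) (x : ℝ) :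
    HasDerivAt m (signedRoot F (m x)) x := by
  rw [signedRoot_of_abs_le (abs_le.2 (hm.mem_Icc x))]
  exact hm.ode x

lemma IsProfile.neg_comp_neg {F m : ℝ → ℝ} (hF : IsStdPotential F) (hm : IsProfile F m) :
    IsProfile F (fun x => -m (-x)) where
  mem_Icc x := by have := hm.mem_Icc (-x); constructor <;> linarith [this.1, this.2]
  ode x := by
    rw [hF.symm]
    exact (((hm.ode (-x)).scomp x (hasDerivAt_neg x)).neg).congr_deriv (by simp)
  limit_top := by simpa using (hm.limit_bot.comp tendsto_neg_atTop_atBot).neg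
  limit_bot := (hm.limit_top.comp tendsto_neg_atBot_atTop).neg
  zero := by simp [hm.zero]

/-- On the right half-line, an approximate solution `u` of the profile equation with `u 0 = 0` is
`H¹`-close to the profile, with a bound linear in the `L²` norm of the defect. -/
lemma exists_half_line_bound {F : ℝ → ℝ} (hF : IsStdPotential F) :
    ∃ K > 0, ∃ G₀ > 0, ∀ m u u' : ℝ → ℝ, IsProfile F m → (∀ x, HasDerivAt u (u' x) x) → u 0 = 0 →
      (∀ a b, IntervalIntegrable (fun x => (u' x - signedRoot F (u x)) ^ 2) volume a b) →
      ∀ G ≤ G₀, (∀ X ≥ 0, ∫ x in 0..X, (u' x - signedRoot F (u x)) ^ 2 ≤ G) →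
      ∀ X ≥ 0, ∫⁻ x in Set.Ioc 0 X,
        ENNReal.ofReal ((u x - m x) ^ 2 + (u' x - signedRoot F (m x)) ^ 2) ≤
          ENNReal.ofReal (K * G) := by
  obtain ⟨L, hL, A, hA, c, hc, η, hη, hstab⟩ := exists_signedRoot_stability hF
  set B := 2 / c * Real.exp A with hB
  have hB0 : 0 < B := by positivity
  refine ⟨(1 + 2 * L ^ 2) * (2 / c * B) + 2, by positivity, η ^ 2 / (2 * B), by positivity,
    fun m u u' hm hu hu0 hint G hG hdef => ?_⟩
  have hm' := hm.hasDerivAt_signedRoot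
  have hmem : ∀ x, 0 ≤ x → m x ∈ Set.Icc (0 : ℝ) 1 := fun x hx =>
    ⟨hm.nonneg_of_nonneg hx, (hm.mem_Icc x).2⟩
  have hcu : Continuous u := continuous_iff_continuousAt.2 fun x => (hu x).continuousAt
  have hcm : Continuous m := continuous_iff_continuousAt.2 fun x => (hm' x).continuousAt
  have hcv : Continuous fun x => (u x - m x) ^ 2 := by fun_prop
  -- weighted energy estimate, as long as `u` stays close to `m`
  have energy : ∀ X ≥ 0, (∀ x ∈ Set.Ico 0 X, |u x - m x| < η) →
      (u X - m X) ^ 2 + c / 2 * ∫ x in 0..X, (u x - m x) ^ 2 ≤ B * G := by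
    intro X hX hsmall
    have hderiv : ∀ x, HasDerivAt (fun x => Real.exp (A * (1 - m x)) * (u x - m x) ^ 2)
        (Real.exp (A * (1 - m x)) * (-A * signedRoot F (m x) * (u x - m x) ^ 2 +
          2 * (u x - m x) * (u' x - signedRoot F (m x)))) x := fun x =>
      (((((hm' x).const_sub 1).const_mul A).exp).mul (((hu x).sub (hm' x)).pow 2)).congr_deriv
        (by simp; ring)
    have hle := intervalIntegral.sub_le_integral_of_hasDeriv_right_of_le hX
      (fun x _ => (hderiv x).continuousAt.continuousWithinAt)
      (fun x _ => (hderiv x).hasDerivWithinAt)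
      (φ := fun x => -(c / 2) * (u x - m x) ^ 2 + B * (u' x - signedRoot F (u x)) ^ 2)
      (((intervalIntegrable_iff_integrableOn_Icc_of_le hX).1
        (((hcv.intervalIntegrable 0 X).const_mul _).add ((hint 0 X).const_mul _))))
      (fun x hx => ?_)
    · rw [intervalIntegral.integral_add ((hcv.intervalIntegrable 0 X).const_mul _)
        ((hint 0 X).const_mul _), intervalIntegral.integral_const_mul,
        intervalIntegral.integral_const_mul] at hle
      have h1 : 1 ≤ Real.exp (A * (1 - m X)) :=
        Real.one_le_exp (mul_nonneg hA.le (by linarith [(hmem X hX).2]))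
      have h2 := mul_le_mul_of_nonneg_left (hdef X hX) hB0.le
      have h3 := le_mul_of_one_le_left (sq_nonneg (u X - m X)) h1
      simp only [hu0, hm.zero, sub_self] at hle
      linarith
    · have hx0 : 0 ≤ x := hx.1.le
      obtain ⟨-, hs⟩ := hstab (m x) (hmem x hx0) (u x - m x) (hsmall x ⟨hx0, hx.2⟩).le
      rw [add_sub_cancel] at hs
      have h1 : 1 ≤ Real.exp (A * (1 - m x)) :=
        Real.one_le_exp (mul_nonneg hA.le (by linarith [(hmem x hx0).2]))
      have h2 : Real.exp (A * (1 - m x)) ≤ Real.exp A :=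
        Real.exp_le_exp.2 (by nlinarith [(hmem x hx0).1])
      set p := Real.exp (A * (1 - m x))
      set v := u x - m x
      set g := u' x - signedRoot F (u x) with hg
      have hu'x : u' x = g + signedRoot F (u x) := by rw [hg]; ring
      have young : 2 * v * g ≤ c / 2 * v ^ 2 + 2 / c * g ^ 2 := by
        have : c / 2 * v ^ 2 + 2 / c * g ^ 2 - 2 * v * g = 2 / c * (g - c / 2 * v) ^ 2 := by
          field_simp; ring
        have : 0 ≤ 2 / c * (g - c / 2 * v) ^ 2 := by positivity
        linarith
      calc p * (-A * signedRoot F (m x) * v ^ 2 + 2 * v * (u' x - signedRoot F (m x)))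
          ≤ p * (-(c / 2) * v ^ 2 + 2 / c * g ^ 2) := by
            refine mul_le_mul_of_nonneg_left ?_ (by positivity)
            rw [hu'x]
            linarith
        _ ≤ -(c / 2) * v ^ 2 + B * g ^ 2 := by
            have h3 := mul_le_mul_of_nonneg_right h1 (show 0 ≤ c / 2 * v ^ 2 by positivity)
            have h4 := mul_le_mul_of_nonneg_right h2 (show 0 ≤ 2 / c * g ^ 2 by positivity)
            rw [hB]
            linarith
  have hG' : B * G < η ^ 2 := by
    have := mul_le_mul_of_nonneg_left hG hB0.le
    have e : B * (η ^ 2 / (2 * B)) = η ^ 2 / 2 := by field_simp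
    have : 0 < η ^ 2 := by positivity
    linarith
  have small : ∀ x, 0 ≤ x → |u x - m x| < η := fun x hx => by
    refine lt_of_forall_Ico_lt (q := fun x => |u x - m x|) (by fun_prop) (fun X hX h => ?_) hx
    have h1 := energy X hX h
    have h2 : 0 ≤ ∫ x in 0..X, (u x - m x) ^ 2 :=
      intervalIntegral.integral_nonneg hX fun x _ => sq_nonneg _
    exact abs_lt_of_sq_lt_sq (by nlinarith) hη.le
  intro X hX
  have hv2 : ∫ x in 0..X, (u x - m x) ^ 2 ≤ 2 / c * (B * G) := by
    have := energy X hX fun x hx => small x hx.1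
    rw [div_mul_eq_mul_div, le_div_iff₀ hc]
    linarith [sq_nonneg (u X - m X)]
  have hI : IntervalIntegrable (fun x => (1 + 2 * L ^ 2) * (u x - m x) ^ 2 +
      2 * (u' x - signedRoot F (u x)) ^ 2) volume 0 X :=
    ((hcv.intervalIntegrable 0 X).const_mul _).add ((hint 0 X).const_mul _)
  calc ∫⁻ x in Set.Ioc 0 X,
        ENNReal.ofReal ((u x - m x) ^ 2 + (u' x - signedRoot F (m x)) ^ 2)
      ≤ ∫⁻ x in Set.Ioc 0 X, ENNReal.ofReal ((1 + 2 * L ^ 2) * (u x - m x) ^ 2 +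
          2 * (u' x - signedRoot F (u x)) ^ 2) := by
        refine setLIntegral_mono' measurableSet_Ioc fun x hx => ENNReal.ofReal_le_ofReal ?_
        obtain ⟨hl, -⟩ := hstab (m x) (hmem x hx.1.le) (u x - m x) (small x hx.1.le).le
        rw [add_sub_cancel] at hl
        have := pow_le_pow_left₀ (abs_nonneg _) hl 2
        rw [sq_abs, mul_pow, sq_abs] at this
        nlinarith [sq_nonneg ((u' x - signedRoot F (u x)) -
          (signedRoot F (u x) - signedRoot F (m x)))]
    _ = ENNReal.ofReal (∫ x in 0..X, ((1 + 2 * L ^ 2) * (u x - m x) ^ 2 +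
          2 * (u' x - signedRoot F (u x)) ^ 2)) := by
        rw [intervalIntegral.integral_of_le hX, ofReal_integral_eq_lintegral_ofReal hI.1
          (ae_of_all _ fun x => by positivity)]
    _ ≤ _ := by
        refine ENNReal.ofReal_le_ofReal ?_
        rw [intervalIntegral.integral_add ((hcv.intervalIntegrable 0 X).const_mul _)
          ((hint 0 X).const_mul _), intervalIntegral.integral_const_mul,
          intervalIntegral.integral_const_mul]
        have h1 := mul_le_mul_of_nonneg_left hv2 (show 0 ≤ 1 + 2 * L ^ 2 by positivity)
        have h2 := hdef X hX
        linarith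

lemma setLIntegral_Ioi_le_of_forall_Ioc {f : ℝ → ℝ≥0∞} {C : ℝ≥0∞}
    (h : ∀ X ≥ 0, ∫⁻ x in Set.Ioc 0 X, f x ≤ C) : ∫⁻ x in Set.Ioi 0, f x ≤ C := by
  have hU : (⋃ n : ℕ, Set.Ioc (0 : ℝ) n) = Set.Ioi 0 := by
    ext x
    simp only [Set.mem_iUnion, Set.mem_Ioc, Set.mem_Ioi]
    exact ⟨fun ⟨_, hx⟩ => hx.1, fun hx => (exists_nat_ge x).imp fun n hn => ⟨hx, hn⟩⟩
  rw [← hU, setLIntegral_iUnion_of_directed]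
  · exact iSup_le fun n => h n n.cast_nonneg
  · exact Monotone.directed_le fun i j hij => Set.Ioc_subset_Ioc_right (Nat.cast_le.2 hij)

lemma lintegral_eq_add_comp_neg (f : ℝ → ℝ≥0∞) :
    ∫⁻ x, f x = (∫⁻ x in Set.Ioi 0, f (-x)) + ∫⁻ x in Set.Ioi 0, f x := by
  rw [← lintegral_add_compl f measurableSet_Ioi (A := Set.Ioi (0 : ℝ)), add_comm, Set.compl_Ioi,
    ← restrict_Iio_eq_restrict_Iic,
    ← (Measure.measurePreserving_neg volume).setLIntegral_comp_preimage_emb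
      (MeasurableEquiv.neg ℝ).measurableEmbedding f (Set.Iio 0)]
  simp

/-- Quantitative stability of the profile: an approximate solution of the profile equation that
vanishes at `0` is `H¹(ℝ)`-close to the profile. -/
lemma exists_profile_stability {F : ℝ → ℝ} (hF : IsStdPotential F) :
    ∃ K > 0, ∃ G₀ > 0, ∀ m u : ℝ → ℝ, IsProfile F m → Differentiable ℝ u → u 0 = 0 →
      (∀ a b, IntervalIntegrable (fun x => (deriv u x - signedRoot F (u x)) ^ 2) volume a b) →
      ∀ G ≤ G₀, (∀ a b, a ≤ b → ∫ x in a..b, (deriv u x - signedRoot F (u x)) ^ 2 ≤ G) →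
      ∫⁻ x, ENNReal.ofReal ((u x - m x) ^ 2 + (deriv u x - deriv m x) ^ 2) ≤
        ENNReal.ofReal (K * G) := by
  obtain ⟨K, hK, G₀, hG₀, half⟩ := exists_half_line_bound hF
  refine ⟨2 * K, by positivity, G₀, hG₀, fun m u hm hu hu0 hint G hG hdef => ?_⟩
  have hG0 : 0 ≤ G := by simpa using hdef 0 0 le_rfl
  have right := half m u (deriv u) hm (fun x => (hu x).hasDerivAt) hu0 hint G hG
    fun X hX => hdef 0 X hX
  have left := half _ (fun x => -u (-x)) (fun x => deriv u (-x)) (hm.neg_comp_neg hF)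
    (fun x => (((hu (-x)).hasDerivAt.scomp x (hasDerivAt_neg x)).neg).congr_deriv (by simp))
    (by simp [hu0])
    (fun a b => by
      simp only [signedRoot_neg hF]
      simpa using (IntervalIntegrable.iff_comp_neg (by simp)).1 (hint (-a) (-b)))
    G hG
    (fun X hX => by
      simp only [signedRoot_neg hF]
      rw [intervalIntegral.integral_comp_neg
        (fun x => (deriv u x - signedRoot F (u x)) ^ 2), neg_zero]
      exact hdef (-X) 0 (by linarith))
  rw [lintegral_eq_add_comp_neg, mul_assoc, two_mul, ENNReal.ofReal_add (by positivity)
    (by positivity)]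
  refine add_le_add (setLIntegral_Ioi_le_of_forall_Ioc fun X hX => ?_)
    (setLIntegral_Ioi_le_of_forall_Ioc fun X hX => ?_)
  · convert left X hX using 4 with x
    rw [(hm.hasDerivAt_signedRoot (-x)).deriv, signedRoot_neg hF]
    ring
  · simpa only [(hm.hasDerivAt_signedRoot _).deriv] using right X hX

lemma Cstar_eq_integral_signedRoot (F : ℝ → ℝ) : Cstar F = ∫ u in (-1 : ℝ)..1, signedRoot F u := by
  refine intervalIntegral.integral_congr fun u hu => ?_
  rw [Set.uIcc_of_le (by norm_num)] at hu
  exact (signedRoot_of_abs_le (abs_le.2 hu)).symm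

/-- The Modica–Mortola identity: the excess energy of a transition layer controls the `L²` norm of
its defect in the profile equation. -/
lemma integral_defect_sq_le {F : ℝ → ℝ} (hF : IsStdPotential F) {u : ℝ → ℝ}
    (hu : Differentiable ℝ u) (htop : Tendsto u atTop (𝓝 1)) (hbot : Tendsto u atBot (𝓝 (-1)))
    {d : ℝ} (hd : 0 ≤ d) (hE : ∫⁻ x, ENNReal.ofReal (1 / 2 * (deriv u x) ^ 2 + F (u x)) ≤
      ENNReal.ofReal (Cstar F + d)) :
    (∀ a b, IntervalIntegrable (fun x => (deriv u x - signedRoot F (u x)) ^ 2) volume a b) ∧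
      ∀ a b, a ≤ b → ∫ x in a..b, (deriv u x - signedRoot F (u x)) ^ 2 ≤ 2 * d := by
  have hW := continuous_signedRoot hF
  have hWu : Continuous fun x => signedRoot F (u x) := hW.comp hu.continuous
  have hFu : Continuous fun x => F (u x) := hF.smooth.continuous.comp hu.continuous
  have hmeas : Measurable (deriv u) := measurable_deriv u
  have he0 : ∀ x, 0 ≤ 1 / 2 * (deriv u x) ^ 2 + F (u x) := fun x => by
    have := hF.nonneg (u x); positivity
  have hC : 0 ≤ Cstar F :=
    intervalIntegral.integral_nonneg (by norm_num) fun _ _ => Real.sqrt_nonneg _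
  have he : Integrable fun x => 1 / 2 * (deriv u x) ^ 2 + F (u x) := by
    refine ⟨(((hmeas.pow_const 2).const_mul _).add hFu.measurable).aestronglyMeasurable, ?_⟩
    rw [hasFiniteIntegral_iff_ofReal (ae_of_all _ he0)]
    exact hE.trans_lt ENNReal.ofReal_lt_top
  have hprod : Integrable fun x => signedRoot F (u x) * deriv u x := by
    refine he.mono' (hWu.measurable.mul hmeas).aestronglyMeasurable (ae_of_all _ fun x => ?_)
    have := signedRoot_sq hF (u x)
    rw [Real.norm_eq_abs, abs_le]
    constructor
    · nlinarith [sq_nonneg (signedRoot F (u x) + deriv u x)]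
    · nlinarith [sq_nonneg (signedRoot F (u x) - deriv u x)]
  have hsq : (fun x => (deriv u x - signedRoot F (u x)) ^ 2) = fun x =>
      2 * (1 / 2 * (deriv u x) ^ 2 + F (u x)) - 2 * (signedRoot F (u x) * deriv u x) := by
    funext x
    linear_combination signedRoot_sq hF (u x)
  have hg : Integrable fun x => (deriv u x - signedRoot F (u x)) ^ 2 := by
    rw [hsq]
    exact (he.const_mul 2).sub (hprod.const_mul 2)
  refine ⟨fun a b => hg.intervalIntegrable, fun a b hab => ?_⟩
  set Φ : ℝ → ℝ := fun y => ∫ s in (0 : ℝ)..y, signedRoot F s with hΦ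
  have hΦd : ∀ y, HasDerivAt Φ (signedRoot F y) y := fun y =>
    intervalIntegral.integral_hasDerivAt_right (hW.intervalIntegrable _ _)
      (hW.stronglyMeasurableAtFilter _ _) hW.continuousAt
  have hΦC : Φ 1 - Φ (-1) = Cstar F := by
    rw [Cstar_eq_integral_signedRoot]
    exact intervalIntegral.integral_interval_sub_left (hW.intervalIntegrable _ _)
      (hW.intervalIntegrable _ _)
  have hΦtop : Tendsto (fun t => Φ (u t)) atTop (𝓝 (Φ 1)) :=
    (hΦd 1).continuousAt.tendsto.comp htop
  have hΦbot : Tendsto (fun t => Φ (u (-t))) atTop (𝓝 (Φ (-1))) :=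
    (hΦd (-1)).continuousAt.tendsto.comp (hbot.comp tendsto_neg_atTop_atBot)
  have hlim : Tendsto (fun t => 2 * (Cstar F + d) - 2 * (Φ (u t) - Φ (u (-t)))) atTop
      (𝓝 (2 * d)) := by
    convert ((hΦtop.sub hΦbot).const_mul 2).const_sub (2 * (Cstar F + d)) using 2
    rw [hΦC]; ring
  have htotal : ∫ x, (1 / 2 * (deriv u x) ^ 2 + F (u x)) ≤ Cstar F + d := by
    rw [integral_eq_lintegral_of_nonneg_ae (ae_of_all _ he0) he.1]
    exact ENNReal.toReal_le_of_le_ofReal (by positivity) hE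
  refine ge_of_tendsto hlim ?_
  filter_upwards [eventually_ge_atTop b, eventually_ge_atTop (-a), eventually_ge_atTop 0]
    with t htb hta ht0
  calc ∫ x in a..b, (deriv u x - signedRoot F (u x)) ^ 2
      ≤ ∫ x in (-t)..t, (deriv u x - signedRoot F (u x)) ^ 2 :=
        intervalIntegral.integral_mono_interval (by linarith) hab htb
          (ae_of_all _ fun x => sq_nonneg _) hg.intervalIntegrable
    _ = 2 * (∫ x in (-t)..t, (1 / 2 * (deriv u x) ^ 2 + F (u x))) -
          2 * (Φ (u t) - Φ (u (-t))) := by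
        rw [hsq, intervalIntegral.integral_sub (he.const_mul 2).intervalIntegrable
          (hprod.const_mul 2).intervalIntegrable, intervalIntegral.integral_const_mul,
          intervalIntegral.integral_const_mul]
        congr 2
        exact intervalIntegral.integral_eq_sub_of_hasDerivAt
          (fun x _ => (hΦd (u x)).comp x (hu x).hasDerivAt) hprod.intervalIntegrable
    _ ≤ _ := by
        have : ∫ x in (-t)..t, (1 / 2 * (deriv u x) ^ 2 + F (u x)) ≤
            ∫ x, (1 / 2 * (deriv u x) ^ 2 + F (u x)) := by
          rw [intervalIntegral.integral_of_le (by linarith)]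
          exact setIntegral_le_integral he (ae_of_all _ he0)
        linarith

/-- The one-dimensional energy lower bound: there are `c₄, δ₄ > 0` such
that every `u : ℝ → ℝ` with `u(±∞) = ±1` and `dist_{H¹(ℝ)}(u, M₀) > δ` (where `δ ≤ δ₄`)
satisfies `𝓕₀(u) > c₄ δ²`. -/
theorem statement8 (F m : ℝ → ℝ) (hF : IsStdPotential F) (hm : IsProfile F m) :
    ∃ c₄ δ₄ : ℝ, 0 < c₄ ∧ 0 < δ₄ ∧
      ∀ δ : ℝ, 0 < δ → δ ≤ δ₄ →
        ∀ u : ℝ → ℝ, Differentiable ℝ u →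
          Tendsto u atTop (𝓝 1) → Tendsto u atBot (𝓝 (-1)) →
          ENNReal.ofReal δ <
            (⨅ ξ : ℝ, (∫⁻ x : ℝ, ENNReal.ofReal
                ((u x - m (x - ξ)) ^ 2 + (deriv u x - deriv m (x - ξ)) ^ 2)) ^ (1/2 : ℝ)) →
          ENNReal.ofReal (Cstar F + c₄ * δ ^ 2) <
            ∫⁻ x : ℝ, ENNReal.ofReal (1/2 * (deriv u x) ^ 2 + F (u x)) := by
  obtain ⟨K, hK, G₀, hG₀, hstab⟩ := exists_profile_stability hF
  refine ⟨1 / (2 * K), √(K * G₀), by positivity, by positivity,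
    fun δ hδ hδ' u hu htop hbot hdist => ?_⟩
  by_contra! hE
  obtain ⟨ξ, hξ⟩ : ∃ ξ, u ξ = 0 :=
    mem_range_of_exists_le_of_exists_ge hu.continuous
      ((hbot.eventually_le_const (by norm_num : (-1 : ℝ) < 0)).exists)
      ((htop.eventually_const_le (by norm_num : (0 : ℝ) < 1)).exists)
  obtain ⟨hint, hdef⟩ := integral_defect_sq_le hF hu htop hbot (by positivity) hE
  have hGδ : 2 * (1 / (2 * K) * δ ^ 2) = δ ^ 2 / K := by field_simp
  rw [hGδ] at hdef
  have hG : δ ^ 2 / K ≤ G₀ := by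
    rw [div_le_iff₀' hK]
    exact (Real.le_sqrt hδ.le (by positivity)).1 hδ'
  have hd : ∀ x, deriv (fun y => u (y + ξ)) x = deriv u (x + ξ) :=
    fun x => deriv_comp_add_const u ξ x
  have hclose := hstab m (fun x => u (x + ξ)) hm (hu.comp (differentiable_id.add_const ξ))
    (by simp [hξ])
    (fun a b => by
      simp only [hd]
      simpa using (hint (a + ξ) (b + ξ)).comp_add_right ξ)
    _ hG
    (fun a b hab => by
      simp only [hd]
      rw [intervalIntegral.integral_comp_add_right
        (fun x => (deriv u x - signedRoot F (u x)) ^ 2)]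
      exact hdef _ _ (by linarith))
  refine hdist.not_ge ((iInf_le _ ξ).trans ?_)
  rw [← lintegral_add_right_eq_self _ ξ]
  simp only [add_sub_cancel_right, hd, mul_div_cancel₀ _ hK.ne'] at hclose ⊢
  calc _ ≤ ENNReal.ofReal (δ ^ 2) ^ (1 / 2 : ℝ) := ENNReal.rpow_le_rpow hclose (by norm_num)
    _ = ENNReal.ofReal δ := by
      rw [ENNReal.ofReal_rpow_of_nonneg (by positivity) (by norm_num), ← Real.sqrt_eq_rpow,
        Real.sqrt_sq hδ.le]

end
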